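/- For every λ ∈ ℂ with λ ≠ 0, the fundamental group of the open subset {(x,y) ∈ ℂ² : xy ≠ λ} of ℂ² (based at any point) is isomorphic to the infinite cyclic group ℤ; in particular its first Betti number equals 1. -/

import Mathlib

open unitInterval in
theorem aux_poly (x : C(I, ℂ)) (ε : ℝ) (hε : 0 < ε) :
    ∃ q : ℝ → ℂ, ContDiff ℝ 1 q ∧ ∀ t : I, ‖q t - x t‖ < ε := by
  obtain ⟨p, hp⟩ := exists_polynomial_near_continuousMap 0 1
    (⟨fun t => (x t).re, by fun_prop⟩ : C(Set.Icc (0:ℝ) 1, ℝ)) (ε/2) (by positivity)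
  obtain ⟨r, hr⟩ := exists_polynomial_near_continuousMap 0 1
    (⟨fun t => (x t).im, by fun_prop⟩ : C(Set.Icc (0:ℝ) 1, ℝ)) (ε/2) (by positivity)
  refine ⟨fun t => ((p.eval t : ℝ) : ℂ) + ((r.eval t : ℝ) : ℂ) * Complex.I, ?_, fun t => ?_⟩
  · have h1 : ContDiff ℝ 1 (fun t : ℝ => p.eval t) := by
      simpa using p.contDiff_aeval (𝕜 := ℝ) (n := 1)
    have h2 : ContDiff ℝ 1 (fun t : ℝ => r.eval t) := by
      simpa using r.contDiff_aeval (𝕜 := ℝ) (n := 1)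
    exact (Complex.ofRealCLM.contDiff.comp h1).add
      ((Complex.ofRealCLM.contDiff.comp h2).mul contDiff_const)
  · have a := (ContinuousMap.norm_coe_le_norm _ t).trans_lt hp
    have b := (ContinuousMap.norm_coe_le_norm _ t).trans_lt hr
    simp only [ContinuousMap.sub_apply, Polynomial.toContinuousMapOn_apply,
      Polynomial.toContinuousMap_apply, ContinuousMap.coe_mk, Real.norm_eq_abs] at a b
    refine (Complex.norm_le_abs_re_add_abs_im _).trans_lt ?_
    simp
    linarith

open unitInterval in
theorem aux_perturb (x : C(I, ℂ)) (h0 : x 0 = 1) (h1 : x 1 = 1) (ε : ℝ) (hε : 0 < ε) :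
    ∃ z : C(I, ℂ), z 0 = 1 ∧ z 1 = 1 ∧ (∀ t, z t ≠ 0) ∧ ∀ t, ‖z t - x t‖ < ε := by
  obtain ⟨q, hq, hqx⟩ := aux_poly x (ε/4) (by positivity)
  have hq0 := hqx 0
  have hq1 := hqx 1
  rw [h0] at hq0
  rw [h1] at hq1
  simp only [Set.Icc.coe_zero, Set.Icc.coe_one] at hq0 hq1
  rw [norm_sub_rev] at hq0 hq1
  let Q : ℝ → ℂ := fun t => q t + (1 - q 0) * ((1 - t : ℝ) : ℂ) + (1 - q 1) * (t : ℂ)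
  have hofr : ContDiff ℝ 1 (fun t : ℝ => (t : ℂ)) := Complex.ofRealCLM.contDiff
  have hofr' : ContDiff ℝ 1 (fun t : ℝ => ((1 - t : ℝ) : ℂ)) :=
    Complex.ofRealCLM.contDiff.comp (contDiff_const.sub contDiff_id)
  have hQ : ContDiff ℝ 1 Q :=
    (hq.add (contDiff_const.mul hofr')).add (contDiff_const.mul hofr)
  have hQx : ∀ t : I, ‖Q t - x t‖ < ε / 2 := by
    intro t
    have e : Q t - x t = (q t - x t) + ((1 - q 0) * ((1 - t : ℝ) : ℂ) + (1 - q 1) * (t : ℂ)) := by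
      simp only [Q]; ring
    rw [e]
    have t0 := t.2.1
    have t1 := t.2.2
    have n1 : ‖(1 - q 0) * ((1 - t : ℝ) : ℂ)‖ ≤ ε/4 * (1 - t) := by
      rw [norm_mul, Complex.norm_real, Real.norm_of_nonneg (by linarith)]
      exact mul_le_mul_of_nonneg_right hq0.le (by linarith)
    have n2 : ‖(1 - q 1) * (t : ℂ)‖ ≤ ε/4 * t := by
      rw [norm_mul, Complex.norm_real, Real.norm_of_nonneg (by linarith)]
      exact mul_le_mul_of_nonneg_right hq1.le (by linarith)
    have := norm_add_le (q t - x t) ((1 - q 0) * ((1 - t : ℝ) : ℂ) + (1 - q 1) * (t : ℂ))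
    have := norm_add_le ((1 - q 0) * ((1 - t : ℝ) : ℂ)) ((1 - q 1) * (t : ℂ))
    have := hqx t
    linarith
  have hden : Dense ((fun t : ℝ => - Q t / ((t : ℂ) * ((1 - t : ℝ) : ℂ))) '' Set.Ioo 0 1)ᶜ := by
    refine ContDiffOn.dense_compl_image_of_dimH_lt_finrank (s := Set.Ioo (0:ℝ) 1) ?_
      (convex_Ioo 0 1) subset_rfl ?_
    · simp only [div_eq_mul_inv]
      refine hQ.neg.contDiffOn.mul ((hofr.mul hofr').contDiffOn.inv ?_)
      intro t ht
      have := ht.1.ne'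
      have h2 : (1 - t) ≠ 0 := by linarith [ht.2]
      exact mul_ne_zero (by exact_mod_cast this) (by exact_mod_cast h2)
    · rw [Complex.finrank_real_complex]
      calc dimH (Set.Ioo (0:ℝ) 1) ≤ dimH (Set.univ : Set ℝ) := dimH_mono (Set.subset_univ _)
        _ = 1 := Real.dimH_univ
        _ < _ := by norm_num
  obtain ⟨c, hc, hcε⟩ := hden.exists_dist_lt 0 (half_pos hε)
  rw [dist_zero_left] at hcε
  refine ⟨⟨fun t : I => Q t + c * ((t : ℂ) * ((1 - t : ℝ) : ℂ)), ?_⟩, ?_, ?_, ?_, ?_⟩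
  · have := hQ.continuous
    fun_prop
  · simp [Q]
  · simp [Q]
  · intro t
    simp only [ContinuousMap.coe_mk]
    by_cases ht0 : t = 0
    · subst ht0; simp [Q]
    by_cases ht1 : t = 1
    · subst ht1; simp [Q]
    intro hz
    apply hc
    have ht0' : (t : ℝ) ≠ 0 := fun h => ht0 (Subtype.ext h)
    have ht1' : (t : ℝ) ≠ 1 := fun h => ht1 (Subtype.ext h)
    have h2 : (1 - t : ℝ) ≠ 0 := sub_ne_zero.2 ht1'.symm
    refine ⟨t, ⟨lt_of_le_of_ne t.2.1 ht0'.symm, lt_of_le_of_ne t.2.2 ht1'⟩, ?_⟩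
    have hne : ((t : ℝ) : ℂ) * ((1 - t : ℝ) : ℂ) ≠ 0 :=
      mul_ne_zero (by exact_mod_cast ht0') (by exact_mod_cast h2)
    simp only
    rw [div_eq_iff hne]
    linear_combination -hz
  · intro t
    simp only [ContinuousMap.coe_mk]
    have t0 := t.2.1
    have t1 := t.2.2
    have n1 : ‖c * ((t : ℂ) * ((1 - t : ℝ) : ℂ))‖ ≤ ‖c‖ := by
      rw [norm_mul, norm_mul, Complex.norm_real, Complex.norm_real,
        Real.norm_of_nonneg t0, Real.norm_of_nonneg (by linarith)]
      have : (t : ℝ) * (1 - t) ≤ 1 := by nlinarith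
      nlinarith [norm_nonneg c]
    have := hQx t
    have e : Q t + c * ((t : ℂ) * ((1 - t : ℝ) : ℂ)) - x t
      = (Q t - x t) + c * ((t : ℂ) * ((1 - t : ℝ) : ℂ)) := by ring
    rw [e]
    have := norm_add_le (Q t - x t) (c * ((t : ℂ) * ((1 - t : ℝ) : ℂ)))
    linarith

/-- the space -/
abbrev XX (lam : ℂ) : Set (ℂ × ℂ) := {w : ℂ × ℂ | w.1 * w.2 ≠ lam}

open unitInterval in
theorem aux_joined {lam : ℂ} (p q : XX lam) (h : I → ℂ × ℂ) (hc : Continuous h)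
    (hm : ∀ t, (h t).1 * (h t).2 ≠ lam) (h0 : h 0 = p) (h1 : h 1 = q) : Joined p q :=
  ⟨{ toFun := fun t => ⟨h t, hm t⟩
     continuous_toFun := by fun_prop
     source' := Subtype.ext h0
     target' := Subtype.ext h1 }⟩

open unitInterval in
theorem aux_homotopic {lam : ℂ} {p q : XX lam} (γ γ' : Path p q) (h : I × I → ℂ × ℂ)
    (hc : Continuous h)
    (hm : ∀ t, (h t).1 * (h t).2 ≠ lam) (h0 : ∀ t, h (0, t) = γ t) (h1 : ∀ t, h (1, t) = γ' t)
    (hp : ∀ s, h (s, 0) = p) (hq : ∀ s, h (s, 1) = q) : γ.Homotopic γ' :=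
  ⟨{ toFun := fun t => ⟨h t, hm t⟩
     continuous_toFun := by fun_prop
     map_zero_left := fun t => Subtype.ext (h0 t)
     map_one_left := fun t => Subtype.ext (h1 t)
     prop' := by
      rintro s t (rfl | ht)
      · apply Subtype.ext
        simp [hp]
      · obtain rfl : t = 1 := ht
        apply Subtype.ext
        simp [hq] }⟩

/-- base point -/
def bp (lam : ℂ) (hlam : lam ≠ 0) : XX lam := ⟨(1, 0), by simpa using hlam.symm⟩

theorem bpv (lam : ℂ) (hlam : lam ≠ 0) : (bp lam hlam).1 = (1, 0) := rfl

theorem aux_ne {lam : ℂ} (hlam : lam ≠ 0) (w : XX lam) : 1 - w.1.1 * w.1.2 / lam ≠ 0 := by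
  intro h
  apply w.2
  field_simp at h
  linear_combination -h

/-- the map to the punctured plane -/
noncomputable def ff (lam : ℂ) (hlam : lam ≠ 0) : C(XX lam, {z : ℂ // z ≠ 0}) where
  toFun w := ⟨1 - w.1.1 * w.1.2 / lam, aux_ne hlam w⟩
  continuous_toFun := by fun_prop

/-- the section -/
noncomputable def ss (lam : ℂ) (hlam : lam ≠ 0) : C({z : ℂ // z ≠ 0}, XX lam) where
  toFun u := ⟨(1, lam * (1 - u.1)), by
    intro h
    have : lam * u.1 = 0 := by linear_combination -h
    exact mul_ne_zero hlam u.2 this⟩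
  continuous_toFun := by fun_prop

theorem aux_all_joined {lam : ℂ} (hlam : lam ≠ 0) (p : XX lam) : Joined p (bp lam hlam) := by
  let o (c : ℂ) : XX lam := ⟨(c, 0), by simpa using hlam.symm⟩
  have ho : ∀ c, Joined (o c) (bp lam hlam) := fun c =>
    aux_joined _ _ (fun t => ((1 - (t : ℂ)) * c + (t : ℂ), 0)) (by fun_prop)
      (fun t => by simpa using hlam.symm) (by simp [o]) (by simp [bp])
  by_cases hx : p.1.1 = 0
  · refine Joined.trans (y := o 0) ?_ (ho 0)
    exact aux_joined _ _ (fun t => (0, (1 - (t : ℂ)) * p.1.2)) (by fun_prop)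
      (fun t => by simpa using hlam.symm) (Prod.ext (by simp [hx]) (by simp)) (by simp [o])
  · refine Joined.trans (y := o p.1.1) ?_ (ho _)
    have hu := aux_ne hlam p
    refine aux_joined _ _ (fun t => (p.1.1, lam * (1 - Complex.exp ((1 - (t : ℂ)) *
      Complex.log (1 - p.1.1 * p.1.2 / lam))) / p.1.1)) (by fun_prop) (fun t => ?_) ?_ (by simp [o])
    · simp only
      rw [mul_div_cancel₀ _ hx]
      intro h
      have : lam * Complex.exp ((1 - (t : ℂ)) *
        Complex.log (1 - p.1.1 * p.1.2 / lam)) = 0 := by linear_combination -h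
      exact mul_ne_zero hlam (Complex.exp_ne_zero _) this
    · ext
      · simp
      · simp [Complex.exp_log hu]
        field_simp

open unitInterval in
theorem aux_avoid {lam : ℂ} (hlam : lam ≠ 0) (γ : Path (bp lam hlam) (bp lam hlam)) :
    ∃ γ' : Path (bp lam hlam) (bp lam hlam), γ.Homotopic γ' ∧ ∀ t, (γ' t).1.1 ≠ 0 := by
  have hpos : ∀ t : I, 0 < ‖(γ t).1.1 * (γ t).1.2 - lam‖ / (1 + ‖(γ t).1.2‖) := fun t =>
    div_pos (norm_pos_iff.2 (sub_ne_zero.2 (γ t).2)) (by positivity)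
  have hcont : Continuous fun t : I => ‖(γ t).1.1 * (γ t).1.2 - lam‖ / (1 + ‖(γ t).1.2‖) := by
    refine Continuous.div (by fun_prop) (by fun_prop) fun t => by positivity
  obtain ⟨t₀, -, ht₀⟩ := isCompact_univ.exists_isMinOn (Set.univ_nonempty) hcont.continuousOn
  set ε := ‖(γ t₀).1.1 * (γ t₀).1.2 - lam‖ / (1 + ‖(γ t₀).1.2‖) with hε
  have hmin : ∀ t : I, ε * (1 + ‖(γ t).1.2‖) ≤ ‖(γ t).1.1 * (γ t).1.2 - lam‖ := fun t => by
    rw [← le_div_iff₀ (by positivity)]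
    exact ht₀ (Set.mem_univ t)
  have hε0 : 0 < ε := hpos t₀
  obtain ⟨z, z0, z1, zne, hz⟩ := aux_perturb ⟨fun t => (γ t).1.1, by fun_prop⟩
    (by simp [bpv]) (by simp [bpv]) ε hε0
  simp only [ContinuousMap.coe_mk] at hz
  have key : ∀ s t : I, ((1 - (s : ℂ)) * (γ t).1.1 + s * z t) * (γ t).1.2 ≠ lam := by
    intro s t h
    have e : (γ t).1.1 * (γ t).1.2 - lam = - ((s : ℂ) * (z t - (γ t).1.1) * (γ t).1.2) := by
      linear_combination h
    have h1 := hmin t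
    rw [e, norm_neg, norm_mul, norm_mul, Complex.norm_real, Real.norm_of_nonneg s.2.1] at h1
    have h2 : (s : ℝ) * ‖z t - (γ t).1.1‖ ≤ ε := by
      have := s.2.2
      have := s.2.1
      nlinarith [hz t, norm_nonneg (z t - (γ t).1.1)]
    nlinarith [norm_nonneg (γ t).1.2]
  refine ⟨{ toFun := fun t => ⟨(z t, (γ t).1.2), by simpa using key 1 t⟩
            continuous_toFun := by fun_prop
            source' := by apply Subtype.ext; simp [z0, bpv]
            target' := by apply Subtype.ext; simp [z1, bpv] }, ?_, zne⟩
  refine aux_homotopic _ _ (fun st => ((1 - (st.1 : ℂ)) * (γ st.2).1.1 + st.1 * z st.2,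
    (γ st.2).1.2)) (by fun_prop) (fun st => key st.1 st.2) ?_ ?_ ?_ ?_
  · intro t; simp
  · intro t; simp
  · intro s; simp [bpv, z0]
  · intro s; simp [bpv, z1]

open unitInterval in
theorem aux_null {lam : ℂ} (hlam : lam ≠ 0) (γ : Path (bp lam hlam) (bp lam hlam))
    (h : (γ.map (ff lam hlam).continuous).Homotopic (Path.refl _)) :
    γ.Homotopic (Path.refl _) := by
  obtain ⟨γ', hγ, hne⟩ := aux_avoid hlam γ
  refine hγ.trans ?_
  have h' : (γ'.map (ff lam hlam).continuous).Homotopic (Path.refl _) :=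
    (hγ.symm.map (ff lam hlam)).trans h
  have hb : ff lam hlam (bp lam hlam) = ⟨Complex.exp 0, Complex.exp_ne_zero 0⟩ := by
    apply Subtype.ext; simp [ff, bpv]
  have hb0 : (γ'.map (ff lam hlam).continuous).toContinuousMap 0 =
    (fun z : ℂ ↦ (⟨_, z.exp_ne_zero⟩ : {z : ℂ // z ≠ 0})) 0 := by
    simpa using hb
  let b := Complex.isCoveringMap_exp.liftPath (γ'.map (ff lam hlam).continuous).toContinuousMap 0 hb0
  have b0 : b 0 = 0 := Complex.isCoveringMap_exp.liftPath_zero _ _ _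
  have b1 : b 1 = 0 := by
    have := Complex.isCoveringMap_exp.liftPath_apply_one_eq_of_homotopicRel h' 0 hb0 hb
    refine this.trans ?_
    have := Complex.isCoveringMap_exp.liftPath_const (e := 0) hb
    exact congrArg (fun f : C(I, ℂ) => f 1) this
  have bl : ∀ t, Complex.exp (b t) = 1 - (γ' t).1.1 * (γ' t).1.2 / lam := fun t =>
    congrArg Subtype.val (congrFun (Complex.isCoveringMap_exp.liftPath_lifts _ _ hb0) t)
  have k : ∀ c : ℂ, c * 0 ≠ lam := fun c => by simpa using hlam.symm
  let γ₂ : Path (bp lam hlam) (bp lam hlam) :=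
    { toFun := fun t => ⟨((γ' t).1.1, 0), k _⟩
      continuous_toFun := by fun_prop
      source' := by apply Subtype.ext; simp [bpv]
      target' := by apply Subtype.ext; simp [bpv] }
  have H1 : γ'.Homotopic γ₂ := by
    refine aux_homotopic _ _ (fun st => ((γ' st.2).1.1,
      lam * (1 - Complex.exp ((1 - (st.1 : ℂ)) * b st.2)) / (γ' st.2).1.1)) ?_ ?_ ?_ ?_ ?_ ?_
    · refine Continuous.prodMk (by fun_prop) (Continuous.div (by fun_prop) (by fun_prop)
        fun st => hne _)
    · intro st h
      simp only at h
      rw [mul_div_cancel₀ _ (hne _)] at h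
      have : lam * Complex.exp ((1 - (st.1 : ℂ)) * b st.2) = 0 := by linear_combination -h
      exact mul_ne_zero hlam (Complex.exp_ne_zero _) this
    · intro t
      have := hne t
      ext
      · simp
      · simp [bl]
        field_simp
    · intro t; simp [γ₂]
    · intro s; simp [b0, bpv]
    · intro s; simp [b1, bpv]
  refine H1.trans ?_
  refine aux_homotopic _ _ (fun st => ((1 - (st.1 : ℂ)) * (γ' st.2).1.1 + st.1, 0)) (by fun_prop)
    (fun st => k _) ?_ ?_ ?_ ?_
  · intro t; simp [γ₂]
  · intro t; simp [bpv]
  · intro s; simp [bpv]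
  · intro s; simp [bpv]

theorem aux_surj {lam : ℂ} (hlam : lam ≠ 0) :
    Function.Surjective (FundamentalGroup.map (ff lam hlam) (bp lam hlam)) := by
  have hb : ss lam hlam (ff lam hlam (bp lam hlam)) = bp lam hlam := by
    apply Subtype.ext; simp [ff, bp, ss]
  intro c
  obtain ⟨δ, rfl⟩ := Path.Homotopic.Quotient.mk_surjective c
  refine ⟨Path.Homotopic.Quotient.mk
    ((δ.map (ss lam hlam).continuous).cast hb.symm hb.symm), ?_⟩
  refine congrArg Path.Homotopic.Quotient.mk ?_
  ext t
  change 1 - 1 * (lam * (1 - (δ t).1)) / lam = (δ t).1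
  field_simp
  ring

theorem aux_inj {lam : ℂ} (hlam : lam ≠ 0) :
    Function.Injective (FundamentalGroup.map (ff lam hlam) (bp lam hlam)) := by
  rw [injective_iff_map_eq_one]
  intro c hc
  obtain ⟨γ, rfl⟩ := Path.Homotopic.Quotient.mk_surjective c
  exact Path.Homotopic.Quotient.eq.2 (aux_null hlam γ (Path.Homotopic.Quotient.eq.1 hc))

theorem aux_pi1 (z : {z : ℂ // z ≠ 0}) :
    Nonempty (FundamentalGroup {z : ℂ // z ≠ 0} z ≃* Multiplicative ℤ) := by
  have e1 := Complex.isAddQuotientCoveringMap_exp.fundamentalGroupEquiv (x := z)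
    ⟨Complex.log z.1, Subtype.ext (Complex.exp_log z.2)⟩
  have hinj : Function.Injective (zmultiplesHom ℂ (2 * Real.pi * Complex.I)) := by
    intro a b h
    have := Complex.two_pi_I_ne_zero
    simp only [zmultiplesHom_apply, zsmul_eq_mul] at h
    exact_mod_cast mul_right_cancel₀ this h
  have e2 : ℤ ≃+ AddSubgroup.zmultiples (2 * Real.pi * Complex.I) :=
    AddMonoidHom.ofInjective hinj
  exact ⟨e1.trans ((MulEquiv.op (AddEquiv.toMultiplicative e2).symm).trans
    (MulEquiv.mk' MulOpposite.opEquiv.symm fun a b => mul_comm _ _))⟩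

/-- For every `λ ≠ 0`, the fundamental group of the open subset
`{(x,y) ∈ ℂ² : xy ≠ λ}` of `ℂ²`, based at any point, is isomorphic to the infinite
cyclic group `ℤ`; in particular its first Betti number equals `1`. -/
theorem fundamentalGroup_complement_smooth_fibre (lam : ℂ) (hlam : lam ≠ 0)
    (pt : ({w : ℂ × ℂ | w.1 * w.2 ≠ lam} : Set (ℂ × ℂ))) :
    Nonempty
      (FundamentalGroup ({w : ℂ × ℂ | w.1 * w.2 ≠ lam} : Set (ℂ × ℂ)) pt ≃*
        Multiplicative ℤ) := by
  obtain ⟨p⟩ := aux_all_joined hlam pt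
  obtain ⟨e⟩ := aux_pi1 (ff lam hlam (bp lam hlam))
  exact ⟨(FundamentalGroup.fundamentalGroupMulEquivOfPath p).trans
    ((MulEquiv.ofBijective _ ⟨aux_inj hlam, aux_surj hlam⟩).trans e)⟩
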